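/- Let u ∈ W^{1,1}_loc(ℝⁿ; ℝ). There is a dimensional constant C = C(n) such that for all λ, μ > 0 the function u is asymmetrically (Cλ, Cμ)-Lipschitz continuous on the set X = {N(∇u)₊ ≤ λ} ∩ {N(∇u)₋ ≤ μ} (at Lebesgue points of u). -/

import Mathlib

open MeasureTheory ENNReal

/-- The asymmetric distance on `ℝ`: `d_{λ,μ}(t) = λt` for `t ≥ 0` and `-μt` for `t < 0`. -/
noncomputable def dAs (lam mu t : ℝ) : ℝ := if 0 ≤ t then lam * t else -(mu * t)

/-- The asymmetric distance on `ℝⁿ`: `d_{λ,μ}(x,y) = ∑ᵢ d_{λ,μ}(xᵢ - yᵢ)`. -/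
noncomputable def dAsV {n : ℕ} (lam mu : ℝ) (x y : Fin n → ℝ) : ℝ :=
  ∑ i, dAs lam mu (x i - y i)

/-- The open axis-parallel rectangle `∏ᵢ (xᵢ - rᵢ, xᵢ + rᵢ)`. -/
def rect {n : ℕ} (x r : Fin n → ℝ) : Set (Fin n → ℝ) :=
  Set.univ.pi fun i => Set.Ioo (x i - r i) (x i + r i)

/-- The strong (rectangular) maximal operator. -/
noncomputable def strongMax {n : ℕ} (u : (Fin n → ℝ) → ℝ) (x : Fin n → ℝ) : ℝ≥0∞ :=
  ⨆ r : {r : Fin n → ℝ // ∀ i, 0 < r i},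
    (∫⁻ z in rect x (r : Fin n → ℝ), ENNReal.ofReal |u z|) / volume (rect x (r : Fin n → ℝ))

/-- `g` is the weak (distributional) gradient of `u`. -/
def IsWeakGrad {n : ℕ} (u : (Fin n → ℝ) → ℝ) (g : (Fin n → ℝ) → (Fin n → ℝ)) : Prop :=
  ∀ φ : (Fin n → ℝ) → ℝ, ContDiff ℝ (⊤ : ℕ∞) φ → HasCompactSupport φ → ∀ i : Fin n,
    ∫ x, u x * fderiv ℝ φ x (Pi.single i 1) = - ∫ x, g x i * φ x

/-- `x` is a Lebesgue point of `u`. -/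
def LebPoint {n : ℕ} (u : (Fin n → ℝ) → ℝ) (x : Fin n → ℝ) : Prop :=
  Filter.Tendsto (fun r : ℝ => ⨍ z in Metric.ball x r, u z)
    (nhdsWithin 0 (Set.Ioi 0)) (nhds (u x))

noncomputable def kk (η : ℝ → ℝ) (r y a t s : ℝ) : ℝ :=
  η ((s - (y + t ^ 2 * a)) / (r + t ^ 2 * |a|)) / (r + t ^ 2 * |a|)

noncomputable def vv (r y a t s : ℝ) : ℝ :=
  2 * t * (a + |a| * ((s - (y + t ^ 2 * a)) / (r + t ^ 2 * |a|)))

noncomputable def LL (η : ℝ → ℝ) (r y a t s : ℝ) : ℝ :=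
  2 * t * (|a| / (r + t ^ 2 * |a|)) * kk η r y a t s +
    vv r y a t s * (deriv η ((s - (y + t ^ 2 * a)) / (r + t ^ 2 * |a|)) /
      (r + t ^ 2 * |a|) / (r + t ^ 2 * |a|))

lemma rho_pos {r : ℝ} (hr : 0 < r) (a t : ℝ) : 0 < r + t ^ 2 * |a| := by positivity

lemma kk_deriv {η : ℝ → ℝ} (hη : Differentiable ℝ η) {r : ℝ} (hr : 0 < r) (y a t s : ℝ) :
    HasDerivAt (fun t => kk η r y a t s) (-LL η r y a t s) t := by
  have hρ := rho_pos hr a t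
  have h1 : HasDerivAt (fun t : ℝ => t ^ 2) (2 * t) t := by simpa using hasDerivAt_pow 2 t
  have h2 : HasDerivAt (fun t : ℝ => r + t ^ 2 * |a|) (2 * t * |a|) t :=
    (h1.mul_const _).const_add r
  have h3 : HasDerivAt (fun t : ℝ => s - (y + t ^ 2 * a)) (-(2 * t * a)) t :=
    ((h1.mul_const a).const_add y).const_sub s
  have h4 := h3.div h2 hρ.ne'
  have h5 := (hη ((s - (y + t ^ 2 * a)) / (r + t ^ 2 * |a|))).hasDerivAt.comp t h4
  have h6 := h5.div h2 hρ.ne'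
  refine HasDerivAt.congr_deriv h6 ?_
  simp only [LL, kk, vv, Function.comp, Pi.div_apply]
  field_simp
  ring

lemma vk_deriv {η : ℝ → ℝ} (hη : Differentiable ℝ η) {r : ℝ} (y a t s : ℝ) :
    HasDerivAt (fun s => vv r y a t s * kk η r y a t s) (LL η r y a t s) s := by
  have h3 : HasDerivAt (fun s : ℝ => (s - (y + t ^ 2 * a)) / (r + t ^ 2 * |a|))
      (1 / (r + t ^ 2 * |a|)) s := ((hasDerivAt_id s).sub_const _).div_const _
  have h4 : HasDerivAt (fun s => vv r y a t s) (2 * t * (|a| * (1 / (r + t ^ 2 * |a|)))) s :=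
    ((h3.const_mul _).const_add _).const_mul _
  have h5 := ((hη ((s - (y + t ^ 2 * a)) / (r + t ^ 2 * |a|))).hasDerivAt.comp s h3).div_const
    (r + t ^ 2 * |a|)
  have h6 := h4.mul h5
  refine HasDerivAt.congr_deriv h6 ?_
  simp only [LL, kk, Function.comp]
  ring

noncomputable def KK {n : ℕ} (η : ℝ → ℝ) (r : ℝ) (y a : Fin n → ℝ) (t : ℝ) (w : Fin n → ℝ) : ℝ :=
  ∏ i, kk η r (y i) (a i) t (w i)

noncomputable def KD {n : ℕ} (η : ℝ → ℝ) (r : ℝ) (y a : Fin n → ℝ) (t : ℝ) (w : Fin n → ℝ) : ℝ :=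
  -∑ i, (∏ j ∈ Finset.univ.erase i, kk η r (y j) (a j) t (w j)) * LL η r (y i) (a i) t (w i)

noncomputable def Ph {n : ℕ} (η : ℝ → ℝ) (r : ℝ) (y a : Fin n → ℝ) (t : ℝ) (i : Fin n)
    (w : Fin n → ℝ) : ℝ :=
  vv r (y i) (a i) t (w i) * KK η r y a t w

lemma KK_deriv {n : ℕ} {η : ℝ → ℝ} (hη : Differentiable ℝ η) {r : ℝ} (hr : 0 < r)
    (y a : Fin n → ℝ) (t : ℝ) (w : Fin n → ℝ) :
    HasDerivAt (fun t => KK η r y a t w) (KD η r y a t w) t := by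
  have := HasDerivAt.fun_finsetProd (u := Finset.univ) (fun i _ => kk_deriv hη hr (y i) (a i) t (w i))
  refine HasDerivAt.congr_deriv this ?_
  simp [KD]

lemma KD_cont {n : ℕ} {η : ℝ → ℝ} (hη : ContDiff ℝ (⊤ : ℕ∞) η) {r : ℝ} (hr : 0 < r)
    (y a : Fin n → ℝ) : Continuous (fun p : ℝ × (Fin n → ℝ) => KD η r y a p.1 p.2) := by
  have h0 := hη.continuous
  have h1 : Continuous (deriv η) := hη.continuous_deriv (by norm_num)
  have h2 : ∀ (a t : ℝ), r + t ^ 2 * |a| ≠ 0 := fun a t => (rho_pos hr a t).ne'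
  unfold KD LL kk vv
  fun_prop (disch := intros; apply h2)

lemma KK_smooth {n : ℕ} {η : ℝ → ℝ} (hη : ContDiff ℝ (⊤ : ℕ∞) η) {r : ℝ}
    (y a : Fin n → ℝ) (t : ℝ) : ContDiff ℝ (⊤ : ℕ∞) (KK η r y a t) := by
  unfold KK kk
  refine contDiff_prod fun i _ => ?_
  refine ContDiff.div_const (hη.comp ?_) _
  fun_prop

lemma Ph_smooth {n : ℕ} {η : ℝ → ℝ} (hη : ContDiff ℝ (⊤ : ℕ∞) η) {r : ℝ}
    (y a : Fin n → ℝ) (t : ℝ) (i : Fin n) : ContDiff ℝ (⊤ : ℕ∞) (Ph η r y a t i) := by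
  unfold Ph
  refine ContDiff.mul ?_ (KK_smooth hη y a t)
  unfold vv
  fun_prop

lemma Ph_deriv {n : ℕ} {η : ℝ → ℝ} (hη : ContDiff ℝ (⊤ : ℕ∞) η) {r : ℝ}
    (y a : Fin n → ℝ) (t : ℝ) (i : Fin n) (w : Fin n → ℝ) :
    fderiv ℝ (Ph η r y a t i) w (Pi.single i 1) =
      (∏ j ∈ Finset.univ.erase i, kk η r (y j) (a j) t (w j)) * LL η r (y i) (a i) t (w i) := by
  have hd : Differentiable ℝ η := hη.differentiable (by norm_num)
  have h1 := ((Ph_smooth hη (r := r) y a t i).differentiable (by norm_num) w).hasFDerivAt.hasLineDerivAt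
    (Pi.single i 1)
  refine h1.unique ?_
  unfold HasLineDerivAt
  have h2 : (fun τ : ℝ => Ph η r y a t i (w + τ • Pi.single i 1)) = fun τ =>
      (∏ j ∈ Finset.univ.erase i, kk η r (y j) (a j) t (w j)) *
       (vv r (y i) (a i) t (w i + τ) * kk η r (y i) (a i) t (w i + τ)) := by
    ext τ
    unfold Ph KK
    rw [← Finset.mul_prod_erase _ _ (Finset.mem_univ i)]
    have : ∏ j ∈ Finset.univ.erase i, kk η r (y j) (a j) t ((w + τ • Pi.single i 1 : Fin n → ℝ) j)
      = ∏ j ∈ Finset.univ.erase i, kk η r (y j) (a j) t (w j) := by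
      refine Finset.prod_congr rfl fun j hj => ?_
      simp [Pi.single_eq_of_ne (Finset.ne_of_mem_erase hj)]
    rw [this]
    simp
    ring
  rw [h2]
  refine HasDerivAt.const_mul _ ?_
  have := vk_deriv hd (r := r) (y i) (a i) t (w i + 0)
  simpa using HasDerivAt.comp_const_add (w i) 0 this

lemma zero_out {r y a t s : ℝ} (hr : 0 < r) (h : r + t ^ 2 * |a| ≤ |s - (y + t ^ 2 * a)|) :
    1 ≤ |(s - (y + t ^ 2 * a)) / (r + t ^ 2 * |a|)| := by
  have hρ := rho_pos hr a t
  rw [abs_div, abs_of_pos hρ, le_div_iff₀ hρ]; linarith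

lemma KKz {n : ℕ} {η : ℝ → ℝ} (h0 : ∀ z, 1 ≤ |z| → η z = 0) {r : ℝ} (hr : 0 < r)
    (y a : Fin n → ℝ) (t : ℝ) (w : Fin n → ℝ) (i : Fin n)
    (h : r + t ^ 2 * |a i| ≤ |w i - (y i + t ^ 2 * a i)|) : KK η r y a t w = 0 := by
  refine Finset.prod_eq_zero (Finset.mem_univ i) ?_
  simp [kk, h0 _ (zero_out hr h)]

lemma KDz {n : ℕ} {η : ℝ → ℝ} (h0 : ∀ z, 1 ≤ |z| → η z = 0) {r : ℝ} (hr : 0 < r)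
    (hd : ∀ z, 1 ≤ |z| → deriv η z = 0)
    (y a : Fin n → ℝ) (t : ℝ) (w : Fin n → ℝ) (i : Fin n)
    (h : r + t ^ 2 * |a i| ≤ |w i - (y i + t ^ 2 * a i)|) : KD η r y a t w = 0 := by
  have hz := zero_out hr h
  have hk : kk η r (y i) (a i) t (w i) = 0 := by simp [kk, h0 _ hz]
  unfold KD
  rw [neg_eq_zero]
  refine Finset.sum_eq_zero fun j _ => ?_
  by_cases hj : i = j
  · subst hj
    simp [LL, hk, hd _ hz]
  · rw [Finset.prod_eq_zero (Finset.mem_erase.2 ⟨hj, Finset.mem_univ i⟩) hk, zero_mul]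

lemma far {n : ℕ} {r : ℝ} (y a : Fin n → ℝ) (t : ℝ) (ht : t ^ 2 ≤ 4) (w : Fin n → ℝ)
    (hw : ‖y‖ + 8 * ‖a‖ + r < ‖w‖) (hr : 0 < r) :
    ∃ i, r + t ^ 2 * |a i| ≤ |w i - (y i + t ^ 2 * a i)| := by
  by_contra! hc
  refine absurd hw (not_lt.2 ?_)
  refine (pi_norm_le_iff_of_nonneg (by positivity)).2 fun i => ?_
  have h1 := hc i
  have hy : |y i| ≤ ‖y‖ := norm_le_pi_norm y i
  have ha : |a i| ≤ ‖a‖ := norm_le_pi_norm a i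
  have h2 : |w i| ≤ |w i - (y i + t ^ 2 * a i)| + (|y i| + t ^ 2 * |a i|) := by
    calc |w i| = |(w i - (y i + t ^ 2 * a i)) + (y i + t ^ 2 * a i)| := by ring_nf
      _ ≤ _ := (abs_add_le _ _).trans (by
        gcongr
        refine (abs_add_le _ _).trans ?_
        rw [abs_mul, abs_of_nonneg (sq_nonneg t)])
  have h3 : t ^ 2 * |a i| ≤ 4 * ‖a‖ := by gcongr
  rw [Real.norm_eq_abs]
  linarith

lemma KK_supp {n : ℕ} {η : ℝ → ℝ} (h0 : ∀ z, 1 ≤ |z| → η z = 0) {r : ℝ} (hr : 0 < r)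
    (y a : Fin n → ℝ) (t : ℝ) (ht : t ^ 2 ≤ 4) : HasCompactSupport (KK η r y a t) := by
  refine HasCompactSupport.intro (isCompact_closedBall (0 : Fin n → ℝ) (‖y‖ + 8 * ‖a‖ + r)) ?_
  intro w hw
  simp only [Metric.mem_closedBall, dist_zero_right, not_le] at hw
  obtain ⟨i, hi⟩ := far y a t ht w hw hr
  exact KKz h0 hr y a t w i hi

lemma main_deriv {n : ℕ} {η : ℝ → ℝ} (hη : ContDiff ℝ (⊤ : ℕ∞) η) (h0 : ∀ z, 1 ≤ |z| → η z = 0)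
    (hd : ∀ z, 1 ≤ |z| → deriv η z = 0)
    {r : ℝ} (hr : 0 < r) (y a : Fin n → ℝ) (u : (Fin n → ℝ) → ℝ) (g : (Fin n → ℝ) → (Fin n → ℝ))
    (hu : LocallyIntegrable u volume) (hg : IsWeakGrad u g) (t : ℝ)
    (ht : t ∈ Set.Icc (0 : ℝ) 1) :
    HasDerivAt (fun t => ∫ w, u w * KK η r y a t w) (∑ i, ∫ w, g w i * Ph η r y a t i w) t := by
  have hdiff : Differentiable ℝ η := hη.differentiable (by norm_num)
  have hsq : ∀ s ∈ Set.Icc (-1 : ℝ) 2, s ^ 2 ≤ 4 := fun s hs => by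
    nlinarith [hs.1, hs.2]
  have ht4 : t ^ 2 ≤ 4 := hsq t ⟨by linarith [ht.1], by linarith [ht.2]⟩
  set M := ‖y‖ + 8 * ‖a‖ + r
  obtain ⟨B, hB⟩ := ((isCompact_Icc (a := (-1 : ℝ)) (b := 2)).prod
    (isCompact_closedBall (0 : Fin n → ℝ) M)).exists_bound_of_continuousOn
    (KD_cont hη hr y a).continuousOn
  have hcont : ∀ s, Continuous (KK η r y a s) := fun s => (KK_smooth hη y a s).continuous
  have key := hasDerivAt_integral_of_dominated_loc_of_deriv_le (μ := (volume : Measure (Fin n → ℝ)))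
    (F := fun t w => u w * KK η r y a t w) (F' := fun t w => u w * KD η r y a t w)
    (bound := (Metric.closedBall (0 : Fin n → ℝ) M).indicator (fun w => ‖u w‖ * B))
    (x₀ := t) (s := Set.Icc (-1) 2)
    (Icc_mem_nhds (by linarith [ht.1]) (by linarith [ht.2]))
    (Filter.Eventually.of_forall fun s => hu.aestronglyMeasurable.mul (hcont s).aestronglyMeasurable)
    (by
      have := hu.integrable_smul_left_of_hasCompactSupport (hcont t) (KK_supp h0 hr y a t ht4)
      simpa [mul_comm] using this)
    (hu.aestronglyMeasurable.mul (((KD_cont hη hr y a).comp (Continuous.prodMk_right t)).aestronglyMeasurable))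
    (Filter.Eventually.of_forall fun w s hs => by
      by_cases hw : w ∈ Metric.closedBall (0 : Fin n → ℝ) M
      · rw [Set.indicator_of_mem hw, norm_mul]
        exact mul_le_mul_of_nonneg_left (hB (s, w) ⟨hs, hw⟩) (norm_nonneg _)
      · rw [Set.indicator_of_notMem hw]
        simp only [Metric.mem_closedBall, dist_zero_right, not_le] at hw
        obtain ⟨i, hi⟩ := far y a s (hsq s hs) w hw hr
        rw [KDz h0 hr hd y a s w i hi]; simp)
    ((integrable_indicator_iff measurableSet_closedBall).2
      ((hu.integrableOn_isCompact (isCompact_closedBall _ _)).norm.mul_const B))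
    (Filter.Eventually.of_forall fun w s hs => (KK_deriv hdiff hr y a s w).const_mul (u w))
  refine HasDerivAt.congr_deriv key.2 ?_
  have hsup : ∀ i, HasCompactSupport (Ph η r y a t i) := fun i =>
    (KK_supp h0 hr y a t ht4).mul_left
  have e1 : ∀ w, u w * KD η r y a t w =
      -∑ i, u w * fderiv ℝ (Ph η r y a t i) w (Pi.single i 1) := fun w => by
    simp only [Ph_deriv hη, KD, Finset.mul_sum, mul_neg]
  simp only [e1]
  rw [integral_neg, integral_finsetSum, ← Finset.sum_neg_distrib]
  · refine Finset.sum_congr rfl fun i _ => ?_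
    rw [hg _ (Ph_smooth hη y a t i) (hsup i) i, neg_neg]
  · intro i _
    have hc : Continuous (fun w => fderiv ℝ (Ph η r y a t i) w (Pi.single i 1)) :=
      ((Ph_smooth hη y a t i).continuous_fderiv (by norm_num)).clm_apply continuous_const
    have hs2 : HasCompactSupport (fun w => fderiv ℝ (Ph η r y a t i) w (Pi.single i 1)) :=
      (hsup i).fderiv_apply ℝ _
    have := hu.integrable_smul_left_of_hasCompactSupport hc hs2
    simpa [mul_comm] using this

lemma smax {n : ℕ} {f : (Fin n → ℝ) → ℝ} (hf : LocallyIntegrable f volume) (h0 : ∀ w, 0 ≤ f w)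
    {lam : ℝ} (hl : 0 < lam) {x : Fin n → ℝ} (h : strongMax f x ≤ ENNReal.ofReal lam)
    (R : Fin n → ℝ) (hR : ∀ i, 0 < R i) :
    ∫ w in rect x R, f w ≤ lam * ∏ i, (2 * R i) := by
  have h1 := (le_iSup (fun r : {r : Fin n → ℝ // ∀ i, 0 < r i} =>
    (∫⁻ z in rect x (r : Fin n → ℝ), ENNReal.ofReal |f z|) / volume (rect x (r : Fin n → ℝ)))
    ⟨R, hR⟩).trans h
  have hv : volume (rect x R) = ENNReal.ofReal (∏ i, (2 * R i)) := by
    unfold rect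
    rw [Real.volume_pi_Ioo, ENNReal.ofReal_prod_of_nonneg (fun i _ => by linarith [hR i])]
    refine Finset.prod_congr rfl fun i _ => ?_
    congr 1; ring
  have hp : 0 < ∏ i, (2 * R i) := Finset.prod_pos fun i _ => by linarith [hR i]
  simp only at h1
  rw [hv, ENNReal.div_le_iff (by simpa using hp) ENNReal.ofReal_ne_top,
    ← ENNReal.ofReal_mul hl.le] at h1
  rw [integral_eq_lintegral_of_nonneg_ae (Filter.Eventually.of_forall h0)
    hf.aestronglyMeasurable.restrict]
  refine ENNReal.toReal_le_of_le_ofReal (by positivity) ?_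
  simpa only [abs_of_nonneg (h0 _)] using h1

lemma rect_meas {n : ℕ} (x R : Fin n → ℝ) : MeasurableSet (rect x R) :=
  MeasurableSet.univ_pi fun _ => measurableSet_Ioo

lemma rect_int {n : ℕ} {f : (Fin n → ℝ) → ℝ} (hf : LocallyIntegrable f volume) (x R : Fin n → ℝ) :
    IntegrableOn f (rect x R) := by
  refine (hf.integrableOn_isCompact (isCompact_univ_pi
    (fun i => isCompact_Icc (a := x i - R i) (b := x i + R i)))).mono_set ?_
  exact Set.pi_mono fun i _ => Set.Ioo_subset_Icc_self

lemma int_bound {n : ℕ} {η : ℝ → ℝ} (hη : ContDiff ℝ (⊤ : ℕ∞) η) (h0 : ∀ z, 1 ≤ |z| → η z = 0)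
    (hη0 : ∀ z, 0 ≤ η z) (hη1 : ∀ z, η z ≤ 1)
    {r : ℝ} (hr : 0 < r) (y a : Fin n → ℝ) (h G : (Fin n → ℝ) → ℝ)
    (hh : LocallyIntegrable h volume) (hG : LocallyIntegrable G volume) (hG0 : ∀ w, 0 ≤ G w)
    (i : Fin n) (hs : ∀ w, h w * a i ≤ |a i| * G w) {lam : ℝ}
    (hm : ∀ R : Fin n → ℝ, (∀ i, 0 < R i) → ∫ w in rect y R, G w ≤ lam * ∏ i, (2 * R i))
    (t : ℝ) (ht : t ∈ Set.Icc (0 : ℝ) 1) :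
    ∫ w, h w * Ph η r y a t i w ≤ 4 ^ (n + 1) * (lam * |a i|) := by
  set ρ : Fin n → ℝ := fun j => r + t ^ 2 * |a j| with hρd
  have hρ : ∀ j, 0 < ρ j := fun j => rho_pos hr (a j) t
  have hP : 0 < ∏ j, ρ j := Finset.prod_pos fun j _ => hρ j
  have ht4 : t ^ 2 ≤ 4 := by nlinarith [ht.1, ht.2]
  have hpt : ∀ w, h w * Ph η r y a t i w ≤
      (rect y (fun j => 2 * ρ j)).indicator (fun w => G w * (4 * |a i| * (∏ j, ρ j)⁻¹)) w := by
    intro w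
    by_cases hw : ∃ j, r + t ^ 2 * |a j| ≤ |w j - (y j + t ^ 2 * a j)|
    · obtain ⟨j, hj⟩ := hw
      unfold Ph
      rw [KKz h0 hr y a t w j hj, mul_zero, mul_zero]
      refine Set.indicator_nonneg (fun w _ => ?_) w
      have := hG0 w
      positivity
    · push Not at hw
      have hmem : w ∈ rect y (fun j => 2 * ρ j) := by
        intro j _
        have h1 := abs_lt.1 (hw j)
        have h2 : |t ^ 2 * a j| ≤ ρ j := by
          rw [abs_mul, abs_of_nonneg (sq_nonneg t)]; simp only [hρd]; linarith
        have h3 := abs_le.1 h2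
        simp only [hρd] at h3 ⊢
        constructor <;> linarith [h1.1, h1.2, h3.1, h3.2]
      rw [Set.indicator_of_mem hmem]
      have hK0 : 0 ≤ KK η r y a t w := Finset.prod_nonneg fun j _ =>
        div_nonneg (hη0 _) (hρ j).le
      have hK1 : KK η r y a t w ≤ (∏ j, ρ j)⁻¹ := by
        rw [← Finset.prod_inv_distrib]
        refine Finset.prod_le_prod (fun j _ => div_nonneg (hη0 _) (hρ j).le) fun j _ => ?_
        unfold kk
        rw [div_eq_mul_inv]
        exact mul_le_of_le_one_left (inv_nonneg.2 (hρ j).le) (hη1 _)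
      have hz : |(w i - (y i + t ^ 2 * a i)) / (r + t ^ 2 * |a i|)| ≤ 1 := by
        rw [abs_div, abs_of_pos (rho_pos hr (a i) t), div_le_one (rho_pos hr (a i) t)]
        exact (hw i).le
      have hv : h w * vv r (y i) (a i) t (w i) ≤ G w * (4 * |a i|) := by
        unfold vv
        set z := (w i - (y i + t ^ 2 * a i)) / (r + t ^ 2 * |a i|)
        obtain ⟨σ, hσ, hσ2⟩ : ∃ σ : ℝ, |a i| = a i * σ ∧ |σ| = 1 := by
          rcases le_total 0 (a i) with h | h
          · exact ⟨1, by rw [abs_of_nonneg h, mul_one], by simp⟩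
          · exact ⟨-1, by rw [abs_of_nonpos h]; ring, by simp⟩
        have hz2 : |σ * z| ≤ 1 := by rw [abs_mul, hσ2, one_mul]; exact hz
        have hz3 := abs_le.1 hz2
        have e : h w * (2 * t * (a i + |a i| * z)) = (h w * a i) * (2 * t * (1 + σ * z)) := by
          rw [hσ]; ring
        rw [e]
        have hnn : 0 ≤ 2 * t * (1 + σ * z) := mul_nonneg (by linarith [ht.1]) (by linarith)
        have hle : 2 * t * (1 + σ * z) ≤ 4 := by nlinarith [ht.1, ht.2]
        have hag : 0 ≤ |a i| * G w := mul_nonneg (abs_nonneg _) (hG0 w)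
        calc _ ≤ (|a i| * G w) * (2 * t * (1 + σ * z)) := mul_le_mul_of_nonneg_right (hs w) hnn
          _ ≤ (|a i| * G w) * 4 := mul_le_mul_of_nonneg_left hle hag
          _ = _ := by ring
      have hag : 0 ≤ G w * (4 * |a i|) := mul_nonneg (hG0 w) (by positivity)
      calc h w * Ph η r y a t i w = (h w * vv r (y i) (a i) t (w i)) * KK η r y a t w := by
            unfold Ph; ring
        _ ≤ (G w * (4 * |a i|)) * KK η r y a t w := mul_le_mul_of_nonneg_right hv hK0
        _ ≤ (G w * (4 * |a i|)) * (∏ j, ρ j)⁻¹ := mul_le_mul_of_nonneg_left hK1 hag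
        _ = _ := by ring
  have hI1 : Integrable (fun w => h w * Ph η r y a t i w) := by
    have := hh.integrable_smul_left_of_hasCompactSupport (Ph_smooth hη (r := r) y a t i).continuous
      (KK_supp h0 hr y a t ht4).mul_left
    simpa [mul_comm] using this
  have hI2 := (integrable_indicator_iff (rect_meas y (fun j => 2 * ρ j))).2
    ((rect_int hG y (fun j => 2 * ρ j)).mul_const (4 * |a i| * (∏ j, ρ j)⁻¹))
  refine (integral_mono hI1 hI2 hpt).trans ?_
  rw [integral_indicator (rect_meas _ _), integral_mul_const]
  have h5 := hm (fun j => 2 * ρ j) (fun j => by linarith [hρ j])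
  have h6 : ∏ j, (2 * (2 * ρ j)) = 4 ^ n * ∏ j, ρ j := by
    rw [show (fun j => 2 * (2 * ρ j)) = fun j => 4 * ρ j by ext; ring, Finset.prod_mul_distrib]
    simp
  rw [h6] at h5
  calc _ ≤ (lam * (4 ^ n * ∏ j, ρ j)) * (4 * |a i| * (∏ j, ρ j)⁻¹) :=
        mul_le_mul_of_nonneg_right h5 (by positivity)
    _ = _ := by field_simp; ring

lemma step {n : ℕ} {η : ℝ → ℝ} (hη : ContDiff ℝ (⊤ : ℕ∞) η) (h0 : ∀ z, 1 ≤ |z| → η z = 0)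
    (hd : ∀ z, 1 ≤ |z| → deriv η z = 0)
    (hη0 : ∀ z, 0 ≤ η z) (hη1 : ∀ z, η z ≤ 1)
    {r : ℝ} (hr : 0 < r) (y a : Fin n → ℝ)
    (u : (Fin n → ℝ) → ℝ) (g : (Fin n → ℝ) → (Fin n → ℝ))
    (hu : LocallyIntegrable u volume) (hgi : LocallyIntegrable g volume) (hg : IsWeakGrad u g)
    {lam mu : ℝ} (hl : 0 < lam) (hm : 0 < mu)
    (h1 : strongMax (fun z => ‖fun i => max (g z i) 0‖) y ≤ ENNReal.ofReal lam)
    (h2 : strongMax (fun z => ‖fun i => max (-(g z i)) 0‖) y ≤ ENNReal.ofReal mu) :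
    (∫ w, u w * KK η r y a 1 w) - (∫ w, u w * KK η r y a 0 w) ≤
      4 ^ (n + 1) * ∑ i, dAs lam mu (a i) := by
  have hgl : ∀ i, LocallyIntegrable (fun w => g w i) volume := fun i => by
    rw [locallyIntegrable_iff] at hgi ⊢
    exact fun k hk => Integrable.eval (hgi k hk) i
  have hGl : ∀ F : (Fin n → ℝ) → (Fin n → ℝ), Continuous F → (∀ v, ‖F v‖ ≤ ‖v‖) →
      LocallyIntegrable (fun w => ‖F (g w)‖) volume := fun F hF hb => by
    rw [locallyIntegrable_iff] at hgi ⊢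
    intro k hk
    refine Integrable.mono (hgi k hk) (hF.norm.comp_aestronglyMeasurable (hgi k hk).aestronglyMeasurable) ?_
    refine Filter.Eventually.of_forall fun w => ?_
    rw [norm_norm]; exact hb _
  have hp := hGl (fun v i => max (v i) 0) (by fun_prop) (fun v => by
    refine (pi_norm_le_iff_of_nonneg (norm_nonneg _)).2 fun i => ?_
    rw [Real.norm_eq_abs, abs_of_nonneg (le_max_right _ _)]
    exact max_le ((le_abs_self _).trans (norm_le_pi_norm v i)) (norm_nonneg _))
  have hn := hGl (fun v i => max (-(v i)) 0) (by fun_prop) (fun v => by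
    refine (pi_norm_le_iff_of_nonneg (norm_nonneg _)).2 fun i => ?_
    rw [Real.norm_eq_abs, abs_of_nonneg (le_max_right _ _)]
    exact max_le ((neg_le_abs _).trans (norm_le_pi_norm v i)) (norm_nonneg _))
  have hbd : ∀ t ∈ Set.Icc (0 : ℝ) 1, ∀ i, ∫ w, g w i * Ph η r y a t i w ≤
      4 ^ (n + 1) * dAs lam mu (a i) := by
    intro t ht i
    unfold dAs
    split_ifs with hai
    · have := int_bound hη h0 hη0 hη1 hr y a _ _ (hgl i) hp (fun w => norm_nonneg _) i
        (fun w => by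
          rw [abs_of_nonneg hai, mul_comm]
          refine mul_le_mul_of_nonneg_left ?_ hai
          refine (le_max_left _ 0).trans ((le_abs_self _).trans ?_)
          exact norm_le_pi_norm (fun i => max (g w i) 0) i)
        (smax hp (fun w => norm_nonneg _) hl h1) t ht
      rwa [abs_of_nonneg hai] at this
    · push Not at hai
      have := int_bound hη h0 hη0 hη1 hr y a _ _ (hgl i) hn (fun w => norm_nonneg _) i
        (fun w => by
          rw [abs_of_neg hai]
          have : -g w i ≤ ‖fun i => max (-(g w i)) 0‖ := by
            refine (le_max_left _ 0).trans ((le_abs_self _).trans ?_)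
            exact norm_le_pi_norm (fun i => max (-(g w i)) 0) i
          nlinarith)
        (smax hn (fun w => norm_nonneg _) hm h2) t ht
      rwa [abs_of_neg hai, mul_neg] at this
  have hder := fun t ht => main_deriv hη h0 hd hr y a u g hu hg t ht
  have := (convex_Icc (0 : ℝ) 1).image_sub_le_mul_sub_of_deriv_le
    (f := fun t => ∫ w, u w * KK η r y a t w)
    (fun t ht => (hder t ht).continuousAt.continuousWithinAt)
    (fun t ht => (hder t (interior_subset ht)).differentiableAt.differentiableWithinAt)
    (C := 4 ^ (n + 1) * ∑ i, dAs lam mu (a i))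
    (fun t ht => by
      rw [(hder t (interior_subset ht)).deriv, Finset.mul_sum]
      exact Finset.sum_le_sum fun i _ => hbd t (interior_subset ht) i)
    0 (by simp) 1 (by simp) zero_le_one
  simpa using this

lemma bumps (k : ℕ) : ∃ η : ℝ → ℝ, ContDiff ℝ (⊤ : ℕ∞) η ∧ (∀ z, 1 ≤ |z| → η z = 0) ∧
    (∀ z, 1 ≤ |z| → deriv η z = 0) ∧ (∀ z, 0 ≤ η z) ∧ (∀ z, η z ≤ 1) ∧
    ∀ z, |z| ≤ 1 - 1 / ((k : ℝ) + 2) → η z = 1 := by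
  have hk : 1 / ((k : ℝ) + 2) < 1 := by
    rw [div_lt_one (by positivity)]; have : (0 : ℝ) ≤ k := by positivity
    linarith
  have hk0 : 0 < 1 / ((k : ℝ) + 2) := by positivity
  let f : ContDiffBump (0 : ℝ) := ⟨1 - 1 / ((k : ℝ) + 2), 1, by linarith, by linarith⟩
  have hz : ∀ z : ℝ, 1 ≤ |z| → f z = 0 := fun z hz => f.zero_of_le_dist (by simpa [f] using hz)
  refine ⟨f, f.contDiff, hz, fun z hz' => ?_, fun z => f.nonneg, fun z => f.le_one, fun z hz' =>
    f.one_of_mem_closedBall (by simpa [f] using hz')⟩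
  refine IsLocalMin.deriv_eq_zero ?_
  refine Filter.Eventually.of_forall fun w => ?_
  rw [hz z hz']; exact f.nonneg

lemma KK_one_eq {n : ℕ} (η : ℝ → ℝ) (r : ℝ) (x y : Fin n → ℝ) :
    KK η r x (fun i => (y i - x i) / 2) 1 = KK η r y (fun i => (x i - y i) / 2) 1 := by
  ext w
  unfold KK kk
  refine Finset.prod_congr rfl fun i _ => ?_
  have e1 : |(y i - x i) / 2| = |(x i - y i) / 2| := by
    rw [← abs_neg]; congr 1; ring
  rw [e1]
  congr 3
  ring

lemma dAs_half (lam mu t : ℝ) : dAs lam mu (t / 2) = dAs lam mu t / 2 := by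
  unfold dAs
  by_cases h : 0 ≤ t
  · rw [if_pos h, if_pos (by linarith)]; ring
  · rw [if_neg h, if_neg (by linarith)]; ring

lemma dAs_swap (lam mu t : ℝ) : dAs mu lam (-t) = dAs lam mu t := by
  unfold dAs
  rcases lt_trichotomy t 0 with h | h | h
  · rw [if_pos (by linarith), if_neg (by linarith)]; ring
  · subst h; simp
  · rw [if_neg (by linarith), if_pos (by linarith)]; ring

lemma KK_lim {n : ℕ} {η : ℕ → ℝ → ℝ} (hc : ∀ k, Continuous (η k))
    (h0 : ∀ k z, 1 ≤ |z| → η k z = 0)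
    (hη0 : ∀ k z, 0 ≤ η k z) (hη1 : ∀ k z, η k z ≤ 1)
    (hη2 : ∀ (k : ℕ) z, |z| ≤ 1 - 1 / ((k : ℝ) + 2) → η k z = 1)
    {r : ℝ} (hr : 0 < r) (y a : Fin n → ℝ)
    (u : (Fin n → ℝ) → ℝ) (hu : LocallyIntegrable u volume) :
    Filter.Tendsto (fun k => ∫ w, u w * KK (η k) r y a 0 w) Filter.atTop
      (nhds (2 ^ n * ⨍ z in Metric.ball y r, u z)) := by
  have hkk : ∀ k w, KK (η k) r y a 0 w = (∏ i, η k ((w i - y i) / r)) * (r ^ n)⁻¹ := by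
    intro k w
    unfold KK kk
    simp [Finset.prod_mul_distrib, div_eq_mul_inv]
  have hz : ∀ w ∉ Metric.ball y r, ∃ i, 1 ≤ |(w i - y i) / r| := by
    intro w hw
    by_contra! hcon
    refine hw ?_
    rw [Metric.mem_ball, dist_pi_lt_iff hr]
    intro i
    have := hcon i
    rwa [abs_div, abs_of_pos hr, div_lt_one hr] at this
  have hlim : 2 ^ n * ⨍ z in Metric.ball y r, u z =
      ∫ w, (Metric.ball y r).indicator (fun w => u w * (r ^ n)⁻¹) w := by
    rw [integral_indicator measurableSet_ball, integral_mul_const, setAverage_eq]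
    have : volume.real (Metric.ball y r) = (2 * r) ^ n := by
      rw [Measure.real, Real.volume_pi_ball _ hr, ENNReal.toReal_ofReal (by positivity)]
      simp
    rw [this, mul_pow, smul_eq_mul]
    field_simp
  rw [hlim]
  refine tendsto_integral_of_dominated_convergence
    ((Metric.ball y r).indicator (fun w => ‖u w‖ * (r ^ n)⁻¹)) ?_ ?_ ?_ ?_
  · intro k
    refine hu.aestronglyMeasurable.mul (Continuous.aestronglyMeasurable ?_)
    have := hc k
    unfold KK kk
    fun_prop
  · refine (integrable_indicator_iff measurableSet_ball).2 ?_
    exact (((hu.integrableOn_isCompact (isCompact_closedBall y r)).mono_set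
      Metric.ball_subset_closedBall).norm.mul_const _)
  · intro k
    refine Filter.Eventually.of_forall fun w => ?_
    rw [hkk]
    by_cases hw : w ∈ Metric.ball y r
    · rw [Set.indicator_of_mem hw, norm_mul, norm_mul, Real.norm_of_nonneg (r := (r ^ n)⁻¹) (by positivity),
        Real.norm_of_nonneg (Finset.prod_nonneg fun i _ => hη0 k _)]
      refine mul_le_mul_of_nonneg_left ?_ (norm_nonneg _)
      exact mul_le_of_le_one_left (by positivity)
        (Finset.prod_le_one (fun i _ => hη0 k _) fun i _ => hη1 k _)
    · rw [Set.indicator_of_notMem hw]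
      obtain ⟨i, hi⟩ := hz w hw
      rw [Finset.prod_eq_zero (Finset.mem_univ i) (h0 k _ hi)]
      simp
  · refine Filter.Eventually.of_forall fun w => ?_
    by_cases hw : w ∈ Metric.ball y r
    · rw [Set.indicator_of_mem hw]
      refine tendsto_const_nhds.congr' ?_
      have hev : ∀ i, ∀ᶠ k : ℕ in Filter.atTop, η k ((w i - y i) / r) = 1 := by
        intro i
        have h1 : |(w i - y i) / r| < 1 := by
          rw [abs_div, abs_of_pos hr, div_lt_one hr]
          exact (dist_pi_lt_iff hr).1 (Metric.mem_ball.1 hw) i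
        have h2 : Filter.Tendsto (fun k : ℕ => 1 - 1 / ((k : ℝ) + 2)) Filter.atTop (nhds (1 - 0)) := by
          refine Filter.Tendsto.const_sub 1 ?_
          refine tendsto_const_nhds.div_atTop ?_
          exact Filter.tendsto_atTop_add_const_right _ _ tendsto_natCast_atTop_atTop
        rw [sub_zero] at h2
        filter_upwards [h2.eventually (lt_mem_nhds h1)] with k hk
        exact hη2 k _ hk.le
      filter_upwards [Filter.eventually_all.2 hev] with k hk
      rw [hkk]
      simp [hk]
    · rw [Set.indicator_of_notMem hw]
      obtain ⟨i, hi⟩ := hz w hw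
      refine tendsto_const_nhds.congr fun k => ?_
      rw [hkk, Finset.prod_eq_zero (Finset.mem_univ i) (h0 k _ hi)]
      simp

/-- A `W^{1,1}_loc` function is asymmetrically `(Cλ, Cμ)`-Lipschitz (at Lebesgue points)
on the set `{N(∇u)₊ ≤ λ} ∩ {N(∇u)₋ ≤ μ}`. -/
theorem stmt11 (n : ℕ) :
    ∃ C : ℝ, 0 < C ∧
      ∀ (u : (Fin n → ℝ) → ℝ) (g : (Fin n → ℝ) → (Fin n → ℝ)),
        LocallyIntegrable u volume → LocallyIntegrable g volume → IsWeakGrad u g →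
        ∀ lam mu : ℝ, 0 < lam → 0 < mu →
          ∀ x y : Fin n → ℝ,
            strongMax (fun z => ‖fun i => max (g z i) 0‖) x ≤ ENNReal.ofReal lam →
            strongMax (fun z => ‖fun i => max (-(g z i)) 0‖) x ≤ ENNReal.ofReal mu →
            strongMax (fun z => ‖fun i => max (g z i) 0‖) y ≤ ENNReal.ofReal lam →
            strongMax (fun z => ‖fun i => max (-(g z i)) 0‖) y ≤ ENNReal.ofReal mu →
            LebPoint u x → LebPoint u y →
            u x - u y ≤ dAsV (C * lam) (C * mu) x y := by
  refine ⟨4 ^ (n + 1), by positivity, ?_⟩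
  intro u g hu hgi hg lam mu hl hm x y hx1 hx2 hy1 hy2 hLx hLy
  have hdC : dAsV (4 ^ (n + 1) * lam) (4 ^ (n + 1) * mu) x y = 4 ^ (n + 1) * dAsV lam mu x y := by
    unfold dAsV dAs
    rw [Finset.mul_sum]
    refine Finset.sum_congr rfl fun i _ => ?_
    split_ifs <;> ring
  rw [hdC]
  have hD0 : 0 ≤ dAsV lam mu x y := Finset.sum_nonneg fun i _ => by
    unfold dAs
    split_ifs with h
    · positivity
    · push Not at h; nlinarith
  choose η hη h0 hd hη0 hη1 hη2 using bumps
  have hgn : IsWeakGrad (fun w => -u w) (fun w => -g w) := by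
    intro φ h1 h2 i
    have := hg φ h1 h2 i
    simp only [neg_mul, integral_neg, Pi.neg_apply, this]
  have hr : ∀ r : ℝ, 0 < r → (⨍ z in Metric.ball x r, u z) - (⨍ z in Metric.ball y r, u z) ≤
      4 ^ (n + 1) * dAsV lam mu x y := by
    intro r hr
    have hk : ∀ k, (∫ w, u w * KK (η k) r x (fun i => (y i - x i) / 2) 0 w) -
        (∫ w, u w * KK (η k) r y (fun i => (x i - y i) / 2) 0 w) ≤
        4 ^ (n + 1) * dAsV lam mu x y := by
      intro k
      have e1 := step (hη k) (h0 k) (hd k) (hη0 k) (hη1 k) hr y (fun i => (x i - y i) / 2)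
        u g hu hgi hg hl hm hy1 hy2
      have e2 := step (hη k) (h0 k) (hd k) (hη0 k) (hη1 k) hr x (fun i => (y i - x i) / 2)
        (fun w => -u w) (fun w => -g w) hu.neg hgi.neg hgn hm hl (by simpa using hx2)
        (by simpa using hx1)
      rw [KK_one_eq] at e2
      simp only [neg_mul, integral_neg] at e2
      have e3 : ∀ i, dAs mu lam ((y i - x i) / 2) = dAs lam mu (x i - y i) / 2 := fun i => by
        rw [dAs_half, ← neg_sub, dAs_swap]
      simp only [e3] at e2
      simp only [dAs_half] at e1
      rw [← Finset.sum_div] at e1 e2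
      unfold dAsV
      linarith
    have hL := le_of_tendsto
      ((KK_lim (fun k => (hη k).continuous) h0 hη0 hη1 hη2 hr x (fun i => (y i - x i) / 2) u hu).sub
      (KK_lim (fun k => (hη k).continuous) h0 hη0 hη1 hη2 hr y (fun i => (x i - y i) / 2) u hu))
      (Filter.Eventually.of_forall hk)
    rw [← mul_sub] at hL
    have h2n : (1 : ℝ) ≤ 2 ^ n := one_le_pow₀ (by norm_num)
    have hR0 : 0 ≤ (4 : ℝ) ^ (n + 1) * dAsV lam mu x y := by positivity
    by_contra! hc
    nlinarith
  refine le_of_tendsto (hLx.sub hLy) ?_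
  filter_upwards [self_mem_nhdsWithin] with r h
  exact hr r h
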